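/- arXiv:1504.01269 — 6 statements merged into one kernel-verified Lean document; each statement's English description precedes it below -/
import Mathlib

section
/- Let Z₁, Z₂, Z₃, Z'₁, Z'₂, Z'₃ be nonzero complex impedances with 1/Z₁ + 1/Z₂ + 1/Z₃ ≠ 0 and Z'₁ + Z'₂ + Z'₃ ≠ 0. Suppose the star and triangle circuits are externally (boundary) equivalent, i.e. for all φ₁, φ₂, φ₃ ∈ ℂ, setting φ₄ = (φ₁/Z₁ + φ₂/Z₂ + φ₃/Z₃)/(1/Z₁ + 1/Z₂ + 1/Z₃), the three boundary-current equalities hold: (−φ₁+φ₄)/Z₁ = (−φ₁+φ₂)/Z'₃ − (φ₁−φ₃)/Z'₂, (−φ₂+φ₄)/Z₂ = −(−φ₁+φ₂)/Z'₃ + (−φ₂+φ₃)/Z'₁, and (−φ₃+φ₄)/Z₃ = −(−φ₂+φ₃)/Z'₁ + (φ₁−φ₃)/Z'₂. Then for every n ∈ {1,2,3}: Zₙ·Z'ₙ = Z'₁Z'₂Z'₃/(Z'₁+Z'₂+Z'₃) = Z₁Z₂ + Z₂Z₃ + Z₃Z₁. -/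
theorem starTriangle_kennelly (Z₁ Z₂ Z₃ Z₁' Z₂' Z₃' : ℂ)
    (hZ₁ : Z₁ ≠ 0) (hZ₂ : Z₂ ≠ 0) (hZ₃ : Z₃ ≠ 0)
    (hZ₁' : Z₁' ≠ 0) (hZ₂' : Z₂' ≠ 0) (hZ₃' : Z₃' ≠ 0)
    (hY : 1/Z₁ + 1/Z₂ + 1/Z₃ ≠ 0)
    (hS : Z₁' + Z₂' + Z₃' ≠ 0)
    (h : ∀ φ₁ φ₂ φ₃ : ℂ,
      (-φ₁ + (φ₁/Z₁ + φ₂/Z₂ + φ₃/Z₃)/(1/Z₁ + 1/Z₂ + 1/Z₃))/Z₁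
        = (-φ₁ + φ₂)/Z₃' - (φ₁ - φ₃)/Z₂' ∧
      (-φ₂ + (φ₁/Z₁ + φ₂/Z₂ + φ₃/Z₃)/(1/Z₁ + 1/Z₂ + 1/Z₃))/Z₂
        = -((-φ₁ + φ₂)/Z₃') + (-φ₂ + φ₃)/Z₁' ∧
      (-φ₃ + (φ₁/Z₁ + φ₂/Z₂ + φ₃/Z₃)/(1/Z₁ + 1/Z₂ + 1/Z₃))/Z₃
        = -((-φ₂ + φ₃)/Z₁') + (φ₁ - φ₃)/Z₂') :
    (Z₁ * Z₁' = Z₁' * Z₂' * Z₃' / (Z₁' + Z₂' + Z₃') ∧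
     Z₂ * Z₂' = Z₁' * Z₂' * Z₃' / (Z₁' + Z₂' + Z₃') ∧
     Z₃ * Z₃' = Z₁' * Z₂' * Z₃' / (Z₁' + Z₂' + Z₃')) ∧
    Z₁' * Z₂' * Z₃' / (Z₁' + Z₂' + Z₃') = Z₁ * Z₂ + Z₂ * Z₃ + Z₃ * Z₁ := by
  have a := (h 0 1 0).1
  have b := (h 0 0 1).1
  have c := (h 0 0 1).2.1
  simp only [neg_zero, zero_div, zero_add, add_zero, sub_zero, zero_sub, neg_div, neg_neg] at a b c
  have hYD : 1/Z₁ + 1/Z₂ + 1/Z₃ = (Z₁ * Z₂ + Z₂ * Z₃ + Z₃ * Z₁) / (Z₁ * Z₂ * Z₃) := by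
    field_simp
    ring
  rw [hYD] at a b c hY
  have hD : Z₁ * Z₂ + Z₂ * Z₃ + Z₃ * Z₁ ≠ 0 := fun h0 => hY (by rw [h0, zero_div])
  generalize hDe : Z₁ * Z₂ + Z₂ * Z₃ + Z₃ * Z₁ = D at *
  have e3 : Z₃ * Z₃' = D := by
    field_simp at a
    linear_combination a
  have e2 : Z₂ * Z₂' = D := by
    field_simp at b
    linear_combination b
  have e1 : Z₁ * Z₁' = D := by
    field_simp at c
    linear_combination c
  have key : Z₁' * Z₂' * Z₃' / (Z₁' + Z₂' + Z₃') = D := by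
    rw [div_eq_iff hS]
    have f1 : Z₁' = D / Z₁ := by rw [eq_div_iff hZ₁, ← e1, mul_comm]
    have f2 : Z₂' = D / Z₂ := by rw [eq_div_iff hZ₂, ← e2, mul_comm]
    have f3 : Z₃' = D / Z₃ := by rw [eq_div_iff hZ₃, ← e3, mul_comm]
    rw [f1, f2, f3]
    field_simp
    linear_combination -hDe
  rw [key]
  exact ⟨⟨e1, e2, e3⟩, rfl⟩
end

section
/- Let Z₁, Z₂, Z₃, Z'₁, Z'₂, Z'₃ be nonzero complex impedances with 1/Z₁ + 1/Z₂ + 1/Z₃ ≠ 0. Suppose that for all φ₁, φ₂, φ₃ ∈ ℂ, setting φ₄ = (φ₁/Z₁ + φ₂/Z₂ + φ₃/Z₃)/(1/Z₁ + 1/Z₂ + 1/Z₃), the three boundary-current equalities hold: (−φ₁+φ₄)/Z₁ = (−φ₁+φ₂)/Z'₃ − (φ₁−φ₃)/Z'₂, (−φ₂+φ₄)/Z₂ = −(−φ₁+φ₂)/Z'₃ + (−φ₂+φ₃)/Z'₁, and (−φ₃+φ₄)/Z₃ = −(−φ₂+φ₃)/Z'₁ + (φ₁−φ₃)/Z'₂.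 Then Z₁·Z'₁ = Z₂·Z'₂. -/
theorem starTriangle_Z1Z1_eq_Z2Z2 (Z₁ Z₂ Z₃ Z₁' Z₂' Z₃' : ℂ)
    (hZ₁ : Z₁ ≠ 0) (hZ₂ : Z₂ ≠ 0) (hZ₃ : Z₃ ≠ 0)
    (hZ₁' : Z₁' ≠ 0) (hZ₂' : Z₂' ≠ 0) (hZ₃' : Z₃' ≠ 0)
    (hY : 1/Z₁ + 1/Z₂ + 1/Z₃ ≠ 0)
    (h : ∀ φ₁ φ₂ φ₃ : ℂ,
      (-φ₁ + (φ₁/Z₁ + φ₂/Z₂ + φ₃/Z₃)/(1/Z₁ + 1/Z₂ + 1/Z₃))/Z₁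
        = (-φ₁ + φ₂)/Z₃' - (φ₁ - φ₃)/Z₂' ∧
      (-φ₂ + (φ₁/Z₁ + φ₂/Z₂ + φ₃/Z₃)/(1/Z₁ + 1/Z₂ + 1/Z₃))/Z₂
        = -((-φ₁ + φ₂)/Z₃') + (-φ₂ + φ₃)/Z₁' ∧
      (-φ₃ + (φ₁/Z₁ + φ₂/Z₂ + φ₃/Z₃)/(1/Z₁ + 1/Z₂ + 1/Z₃))/Z₃
        = -((-φ₂ + φ₃)/Z₁') + (φ₁ - φ₃)/Z₂') :
    Z₁ * Z₁' = Z₂ * Z₂' := by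
  obtain ⟨a, b, -⟩ := h 0 0 1
  generalize (0/Z₁ + 0/Z₂ + 1/Z₃)/(1/Z₁ + 1/Z₂ + 1/Z₃) = t at a b
  have a' : t / Z₁ = 1 / Z₂' := by linear_combination a
  have b' : t / Z₂ = 1 / Z₁' := by linear_combination b
  rw [div_eq_div_iff hZ₁ hZ₂'] at a'
  rw [div_eq_div_iff hZ₂ hZ₁'] at b'
  linear_combination Z₂' * b' - Z₁' * a'
end

section
/- Let Z₁, Z₂, Z₃, Z'₁, Z'₂, Z'₃ be nonzero complex impedances with 1/Z₁ + 1/Z₂ + 1/Z₃ ≠ 0. Suppose that for all φ₁, φ₂, φ₃ ∈ ℂ, setting φ₄ = (φ₁/Z₁ + φ₂/Z₂ + φ₃/Z₃)/(1/Z₁ + 1/Z₂ + 1/Z₃), the three boundary-current equalities hold: (−φ₁+φ₄)/Z₁ = (−φ₁+φ₂)/Z'₃ − (φ₁−φ₃)/Z'₂, (−φ₂+φ₄)/Z₂ = −(−φ₁+φ₂)/Z'₃ + (−φ₂+φ₃)/Z'₁, and (−φ₃+φ₄)/Z₃ = −(−φ₂+φ₃)/Z'₁ + (φ₁−φ₃)/Z'₂.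 Then Z₂·Z'₂ = Z₃·Z'₃. -/
theorem starTriangle_Z2Z2_eq_Z3Z3 (Z₁ Z₂ Z₃ Z₁' Z₂' Z₃' : ℂ)
    (hZ₁ : Z₁ ≠ 0) (hZ₂ : Z₂ ≠ 0) (hZ₃ : Z₃ ≠ 0)
    (hZ₁' : Z₁' ≠ 0) (hZ₂' : Z₂' ≠ 0) (hZ₃' : Z₃' ≠ 0)
    (hY : 1/Z₁ + 1/Z₂ + 1/Z₃ ≠ 0)
    (h : ∀ φ₁ φ₂ φ₃ : ℂ,
      (-φ₁ + (φ₁/Z₁ + φ₂/Z₂ + φ₃/Z₃)/(1/Z₁ + 1/Z₂ + 1/Z₃))/Z₁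
        = (-φ₁ + φ₂)/Z₃' - (φ₁ - φ₃)/Z₂' ∧
      (-φ₂ + (φ₁/Z₁ + φ₂/Z₂ + φ₃/Z₃)/(1/Z₁ + 1/Z₂ + 1/Z₃))/Z₂
        = -((-φ₁ + φ₂)/Z₃') + (-φ₂ + φ₃)/Z₁' ∧
      (-φ₃ + (φ₁/Z₁ + φ₂/Z₂ + φ₃/Z₃)/(1/Z₁ + 1/Z₂ + 1/Z₃))/Z₃
        = -((-φ₂ + φ₃)/Z₁') + (φ₁ - φ₃)/Z₂') :
    Z₂ * Z₂' = Z₃ * Z₃' := by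
  have h2 := (h 0 1 0).1
  have h3 := (h 0 0 1).1
  generalize 1/Z₁ + 1/Z₂ + 1/Z₃ = Y at *
  have e2 : Z₃' = Z₁ * Z₂ * Y := by
    simp only [zero_div, neg_zero, zero_add, add_zero, sub_zero] at h2
    field_simp at h2
    linear_combination h2
  have e3 : Z₂' = Z₁ * Z₃ * Y := by
    simp only [zero_div, neg_zero, zero_add, add_zero, zero_sub, neg_div, neg_neg] at h3
    field_simp at h3
    linear_combination h3
  rw [e2, e3]
  ring
end

section
/- Let Z₁, Z₂, Z₃, Z'₁, Z'₂, Z'₃ be nonzero complex impedances with 1/Z₁ + 1/Z₂ + 1/Z₃ ≠ 0 and Z'₁ + Z'₂ + Z'₃ ≠ 0. Suppose that for all φ₁, φ₂, φ₃ ∈ ℂ, setting φ₄ = (φ₁/Z₁ + φ₂/Z₂ + φ₃/Z₃)/(1/Z₁ + 1/Z₂ + 1/Z₃), the three boundary-current equalities hold: (−φ₁+φ₄)/Z₁ = (−φ₁+φ₂)/Z'₃ − (φ₁−φ₃)/Z'₂, (−φ₂+φ₄)/Z₂ = −(−φ₁+φ₂)/Z'₃ + (−φ₂+φ₃)/Z'₁,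 and (−φ₃+φ₄)/Z₃ = −(−φ₂+φ₃)/Z'₁ + (φ₁−φ₃)/Z'₂. Then Z₁ = Z'₂·Z'₃/(Z'₁ + Z'₂ + Z'₃). -/
theorem starTriangle_Z1 (Z₁ Z₂ Z₃ Z₁' Z₂' Z₃' : ℂ)
    (hZ₁ : Z₁ ≠ 0) (hZ₂ : Z₂ ≠ 0) (hZ₃ : Z₃ ≠ 0)
    (hZ₁' : Z₁' ≠ 0) (hZ₂' : Z₂' ≠ 0) (hZ₃' : Z₃' ≠ 0)
    (hY : 1/Z₁ + 1/Z₂ + 1/Z₃ ≠ 0)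
    (hS : Z₁' + Z₂' + Z₃' ≠ 0)
    (h : ∀ φ₁ φ₂ φ₃ : ℂ,
      (-φ₁ + (φ₁/Z₁ + φ₂/Z₂ + φ₃/Z₃)/(1/Z₁ + 1/Z₂ + 1/Z₃))/Z₁
        = (-φ₁ + φ₂)/Z₃' - (φ₁ - φ₃)/Z₂' ∧
      (-φ₂ + (φ₁/Z₁ + φ₂/Z₂ + φ₃/Z₃)/(1/Z₁ + 1/Z₂ + 1/Z₃))/Z₂
        = -((-φ₁ + φ₂)/Z₃') + (-φ₂ + φ₃)/Z₁' ∧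
      (-φ₃ + (φ₁/Z₁ + φ₂/Z₂ + φ₃/Z₃)/(1/Z₁ + 1/Z₂ + 1/Z₃))/Z₃
        = -((-φ₂ + φ₃)/Z₁') + (φ₁ - φ₃)/Z₂') :
    Z₁ = Z₂' * Z₃' / (Z₁' + Z₂' + Z₃') := by
  have a := (h 0 1 0).1
  have b := (h 0 0 1).1
  have c := (h 0 0 1).2.1
  obtain ⟨Y, hYd⟩ : ∃ Y, Y = 1/Z₁ + 1/Z₂ + 1/Z₃ := ⟨_, rfl⟩
  rw [← hYd] at a b c hY
  have a' : Z₃' = Y * Z₁ * Z₂ := by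
    simp at a
    field_simp at a
    linear_combination a
  have b' : Z₂' = Y * Z₁ * Z₃ := by
    simp at b
    field_simp at b
    linear_combination b
  have c' : Z₁' = Y * Z₂ * Z₃ := by
    simp at c
    field_simp at c
    linear_combination c
  have d : Y * (Z₁ * Z₂ * Z₃) = Z₂ * Z₃ + Z₁ * Z₃ + Z₁ * Z₂ := by
    rw [hYd]
    field_simp
    try ring
  rw [eq_div_iff hS, a', b', c']
  linear_combination (-Y * Z₁) * d
end

section
/- Let Z₁, Z₂, Z₃, Z'₁, Z'₂, Z'₃ be nonzero complex impedances with 1/Z₁ + 1/Z₂ + 1/Z₃ ≠ 0 and Z'₁ + Z'₂ + Z'₃ ≠ 0. Suppose that for all φ₁, φ₂, φ₃ ∈ ℂ, setting φ₄ = (φ₁/Z₁ + φ₂/Z₂ + φ₃/Z₃)/(1/Z₁ + 1/Z₂ + 1/Z₃), the three boundary-current equalities hold: (−φ₁+φ₄)/Z₁ = (−φ₁+φ₂)/Z'₃ − (φ₁−φ₃)/Z'₂, (−φ₂+φ₄)/Z₂ = −(−φ₁+φ₂)/Z'₃ + (−φ₂+φ₃)/Z'₁, and (−φ₃+φ₄)/Z₃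 = −(−φ₂+φ₃)/Z'₁ + (φ₁−φ₃)/Z'₂. Then Z₂ = Z'₁·Z'₃/(Z'₁ + Z'₂ + Z'₃). -/
theorem starTriangle_Z2 (Z₁ Z₂ Z₃ Z₁' Z₂' Z₃' : ℂ)
    (hZ₁ : Z₁ ≠ 0) (hZ₂ : Z₂ ≠ 0) (hZ₃ : Z₃ ≠ 0)
    (hZ₁' : Z₁' ≠ 0) (hZ₂' : Z₂' ≠ 0) (hZ₃' : Z₃' ≠ 0)
    (hY : 1/Z₁ + 1/Z₂ + 1/Z₃ ≠ 0)
    (hS : Z₁' + Z₂' + Z₃' ≠ 0)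
    (h : ∀ φ₁ φ₂ φ₃ : ℂ,
      (-φ₁ + (φ₁/Z₁ + φ₂/Z₂ + φ₃/Z₃)/(1/Z₁ + 1/Z₂ + 1/Z₃))/Z₁
        = (-φ₁ + φ₂)/Z₃' - (φ₁ - φ₃)/Z₂' ∧
      (-φ₂ + (φ₁/Z₁ + φ₂/Z₂ + φ₃/Z₃)/(1/Z₁ + 1/Z₂ + 1/Z₃))/Z₂
        = -((-φ₁ + φ₂)/Z₃') + (-φ₂ + φ₃)/Z₁' ∧
      (-φ₃ + (φ₁/Z₁ + φ₂/Z₂ + φ₃/Z₃)/(1/Z₁ + 1/Z₂ + 1/Z₃))/Z₃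
        = -((-φ₂ + φ₃)/Z₁') + (φ₁ - φ₃)/Z₂') :
    Z₂ = Z₁' * Z₃' / (Z₁' + Z₂' + Z₃') := by
  have a := (h 0 1 0).1
  have b := (h 0 0 1).1
  have c := (h 0 0 1).2.1
  clear h
  have e : (1/Z₁ + 1/Z₂ + 1/Z₃) * (Z₁ * Z₂ * Z₃) = Z₂ * Z₃ + Z₁ * Z₃ + Z₁ * Z₂ := by
    field_simp
  generalize 1/Z₁ + 1/Z₂ + 1/Z₃ = Y at *
  have haeq : Z₃' = Y * Z₁ * Z₂ := by
    simp at a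
    field_simp at a
    linear_combination a
  have hbeq : Z₂' = Y * Z₁ * Z₃ := by
    simp at b
    field_simp at b
    linear_combination b
  have hceq : Z₁' = Y * Z₂ * Z₃ := by
    simp at c
    field_simp at c
    linear_combination c
  rw [eq_div_iff hS, haeq, hbeq, hceq]
  linear_combination (-Y * Z₂) * e
end

section
/- Let Z₁, Z₂, Z₃, Z'₁, Z'₂, Z'₃ be nonzero complex impedances with 1/Z₁ + 1/Z₂ + 1/Z₃ ≠ 0 and Z'₁ + Z'₂ + Z'₃ ≠ 0. Suppose that for all φ₁, φ₂, φ₃ ∈ ℂ, setting φ₄ = (φ₁/Z₁ + φ₂/Z₂ + φ₃/Z₃)/(1/Z₁ + 1/Z₂ + 1/Z₃), the three boundary-current equalities hold: (−φ₁+φ₄)/Z₁ = (−φ₁+φ₂)/Z'₃ − (φ₁−φ₃)/Z'₂, (−φ₂+φ₄)/Z₂ = −(−φ₁+φ₂)/Z'₃ + (−φ₂+φ₃)/Z'₁, and (−φ₃+φ₄)/Z₃ = −(−φ₂+φ₃)/Z'₁ + (φ₁−φ₃)/Z'₂. Then Z₃ = Z'₁·Z'₂/(Z'₁ + Z'₂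 + Z'₃). -/
theorem starTriangle_Z3 (Z₁ Z₂ Z₃ Z₁' Z₂' Z₃' : ℂ)
    (hZ₁ : Z₁ ≠ 0) (hZ₂ : Z₂ ≠ 0) (hZ₃ : Z₃ ≠ 0)
    (hZ₁' : Z₁' ≠ 0) (hZ₂' : Z₂' ≠ 0) (hZ₃' : Z₃' ≠ 0)
    (hY : 1/Z₁ + 1/Z₂ + 1/Z₃ ≠ 0)
    (hS : Z₁' + Z₂' + Z₃' ≠ 0)
    (h : ∀ φ₁ φ₂ φ₃ : ℂ,
      (-φ₁ + (φ₁/Z₁ + φ₂/Z₂ + φ₃/Z₃)/(1/Z₁ + 1/Z₂ + 1/Z₃))/Z₁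
        = (-φ₁ + φ₂)/Z₃' - (φ₁ - φ₃)/Z₂' ∧
      (-φ₂ + (φ₁/Z₁ + φ₂/Z₂ + φ₃/Z₃)/(1/Z₁ + 1/Z₂ + 1/Z₃))/Z₂
        = -((-φ₁ + φ₂)/Z₃') + (-φ₂ + φ₃)/Z₁' ∧
      (-φ₃ + (φ₁/Z₁ + φ₂/Z₂ + φ₃/Z₃)/(1/Z₁ + 1/Z₂ + 1/Z₃))/Z₃
        = -((-φ₂ + φ₃)/Z₁') + (φ₁ - φ₃)/Z₂') :
    Z₃ = Z₁' * Z₂' / (Z₁' + Z₂' + Z₃') := by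
  have a := (h 0 1 0).1
  have b := (h 0 0 1).1
  have c := (h 0 0 1).2.1
  have hP : Z₂ * Z₃ + Z₁ * Z₃ + Z₁ * Z₂ = (1/Z₁ + 1/Z₂ + 1/Z₃) * (Z₁ * Z₂ * Z₃) := by
    field_simp
  generalize 1/Z₁ + 1/Z₂ + 1/Z₃ = Y at *
  have e3 : Z₃' = Z₁ * Z₂ * Y := by
    simp at a
    field_simp at a
    linear_combination a
  have e2 : Z₂' = Z₁ * Z₃ * Y := by
    simp at b
    field_simp at b
    linear_combination b
  have e1 : Z₁' = Z₂ * Z₃ * Y := by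
    simp at c
    field_simp at c
    linear_combination c
  rw [eq_div_iff hS, e1, e2, e3]
  linear_combination Z₃ * Y * hP
end
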